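/- Let k ≥ 4, 1 ≤ a ≤ k−3, m ≥ 1, and let V^λ be an irreducible highest weight U_q(sl_k)-module with highest weight λ = mω_a and highest weight vector v_λ. For all a+1 ≤ a′ ≤ k−2 and all 0 ≤ j ≤ m: f_{a′} f_{a′+1}^{(j)} f_{a′}^{(j)} ⋯ f_{a+1}^{(j)} f_a^{(j)} v_λ = 0. -/

import Mathlib

/-!
Common setup: the quantum group `U_q(sl_k)` (presented by generators
`e_i, f_i, K_i = q^{h_i}, K_i⁻¹` for `1 ≤ i ≤ k-1` and the standard relations)
over the field `KK = ℚ(q)`, and the notion of an irreducible highest weight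
module.  Weights are recorded as functions `μ : ℕ → ℤ`, `μ i` being the value
`μ(h_i)` on the `i`-th simple coroot.
-/

noncomputable section
namespace QSL

abbrev KK : Type := RatFunc ℚ

/-- the variable `q`. -/
def qv : KK := RatFunc.X

/-- the quantum integer `[n]_q = (qⁿ - q⁻ⁿ)/(q - q⁻¹)`. -/
def qInt (n : ℕ) : KK := (qv ^ n - qv⁻¹ ^ n) / (qv - qv⁻¹)

/-- the quantum factorial `[n]_q!`. -/
def qFact : ℕ → KK
  | 0 => 1
  | n + 1 => qFact n * qInt (n + 1)

/-- the Gaussian binomial coefficient `[m choose j]_q`. -/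
def qBinom (m j : ℕ) : KK :=
  (∏ t ∈ Finset.range j, qInt (m - t)) / (∏ t ∈ Finset.range j, qInt (j - t))

/-- the Cartan matrix of `sl`:  `cartan i j = αⱼ(h_i)`. -/
def cartan (i j : ℕ) : ℤ := if i = j then 2 else if i + 1 = j ∨ j + 1 = i then -1 else 0

/-- The quantum group with `d` nodes (`d = k - 1` for `U_q(sl_k)`): a unital
associative `ℚ(q)`-algebra generated by elements `e i, f i, K i, Kinv i`
(`1 ≤ i ≤ d`, where `K i = q^{h_i}`) subject to the standard relations. -/
structure QGroup (d : ℕ) where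
  U : Type
  [ring : Ring U]
  [alg : Algebra KK U]
  e : ℕ → U
  f : ℕ → U
  K : ℕ → U
  Kinv : ℕ → U
  K_mul_Kinv : ∀ i, 1 ≤ i → i ≤ d → K i * Kinv i = 1
  Kinv_mul_K : ∀ i, 1 ≤ i → i ≤ d → Kinv i * K i = 1
  K_comm : ∀ i j, 1 ≤ i → i ≤ d → 1 ≤ j → j ≤ d → K i * K j = K j * K i
  K_e_Kinv : ∀ i j, 1 ≤ i → i ≤ d → 1 ≤ j → j ≤ d →
      K i * e j * Kinv i = (qv ^ cartan i j) • e j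
  K_f_Kinv : ∀ i j, 1 ≤ i → i ≤ d → 1 ≤ j → j ≤ d →
      K i * f j * Kinv i = (qv ^ (-cartan i j)) • f j
  e_f_comm : ∀ i j, 1 ≤ i → i ≤ d → 1 ≤ j → j ≤ d →
      e i * f j - f j * e i = if i = j then (qv - qv⁻¹)⁻¹ • (K i - Kinv i) else 0
  serre_e : ∀ i j, 1 ≤ i → i ≤ d → 1 ≤ j → j ≤ d → (i + 1 = j ∨ j + 1 = i) →
      e i * e i * e j - (qv + qv⁻¹) • (e i * e j * e i) + e j * e i * e i = 0
  serre_f : ∀ i j, 1 ≤ i → i ≤ d → 1 ≤ j → j ≤ d → (i + 1 = j ∨ j + 1 = i) →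
      f i * f i * f j - (qv + qv⁻¹) • (f i * f j * f i) + f j * f i * f i = 0
  comm_e : ∀ i j, 1 ≤ i → i ≤ d → 1 ≤ j → j ≤ d → (i + 1 < j ∨ j + 1 < i) →
      e i * e j = e j * e i
  comm_f : ∀ i j, 1 ≤ i → i ≤ d → 1 ≤ j → j ≤ d → (i + 1 < j ∨ j + 1 < i) →
      f i * f j = f j * f i
  gen : ∀ x : U, x ∈ Algebra.adjoin KK
      {y : U | ∃ i, 1 ≤ i ∧ i ≤ d ∧ (y = e i ∨ y = f i ∨ y = K i ∨ y = Kinv i)}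

attribute [instance] QGroup.ring QGroup.alg

variable {d : ℕ} (G : QGroup d)

/-- the divided power `f_i^{(n)} = f_iⁿ/[n]_q!`. -/
def fDiv (i n : ℕ) : G.U := (qFact n)⁻¹ • (G.f i) ^ n

/-- the divided power `e_i^{(n)} = e_iⁿ/[n]_q!`. -/
def eDiv (i n : ℕ) : G.U := (qFact n)⁻¹ • (G.e i) ^ n

variable {V : Type} [AddCommGroup V] [Module KK V] [Module G.U V] [IsScalarTower KK G.U V]

/-- `u` is a weight vector of weight `μ` (recorded via `μ i = μ(h_i)`). -/
def IsWtVec (u : V) (μ : ℕ → ℤ) : Prop :=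
  ∀ i, 1 ≤ i → i ≤ d → G.K i • u = (qv ^ μ i) • u

/-- `V` is an irreducible highest weight module over `G` with highest weight
`lam` and highest weight vector `v`: it is finite dimensional over `ℚ(q)`,
has a weight space decomposition, `v` is a nonzero weight vector of weight
`lam` annihilated by the `e_i`, `V` is generated by `v`, and `V` is
irreducible. -/
structure IsHWModule (lam : ℕ → ℤ) (v : V) : Prop where
  findim : FiniteDimensional KK V
  ne_zero : v ≠ 0
  wt : IsWtVec G v lam
  hw : ∀ i, 1 ≤ i → i ≤ d → G.e i • v = 0
  gen : ∀ w : V, ∃ p : G.U, p • v = w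
  irred : ∀ W : Submodule G.U V, W = ⊥ ∨ W = ⊤
  decomp : Submodule.span KK {u : V | ∃ μ : ℕ → ℤ, IsWtVec G u μ} = ⊤

/-- the weight `m ω_a`. -/
def omWt (a m : ℕ) : ℕ → ℤ := fun i => if i = a then (m : ℤ) else 0

/-- the weight `j ω_{a-1} + (m - j) ω_a`. -/
def hookWt (a m j : ℕ) : ℕ → ℤ := fun i =>
  (if i = a - 1 then (j : ℤ) else 0) + (if i = a then (m : ℤ) - (j : ℤ) else 0)

/-- `f_{a'}^{(c_{a'})} ⋯ f_{a+1}^{(c_{a+1})} f_a^{(c_a)} • v`. -/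
def fDivChain (c : ℕ → ℕ) (a a' : ℕ) (v : V) : V :=
  (List.range (a' + 1 - a)).foldl (fun u r => fDiv G (a + r) (c (a + r)) • u) v

/-! ### The parameter `q` -/

lemma qv_ne_zero : qv ≠ 0 := RatFunc.X_ne_zero

lemma intDegree_qv_pow (n : ℕ) : (qv ^ n).intDegree = n := by
  induction n with
  | zero => simp
  | succ n ih =>
    rw [pow_succ, RatFunc.intDegree_mul (pow_ne_zero _ qv_ne_zero) qv_ne_zero, ih]
    simp [qv]

lemma qv_zpow_ne_one {n : ℤ} (hn : n ≠ 0) : qv ^ n ≠ 1 := by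
  have key : ∀ m : ℕ, qv ^ m = 1 → m = 0 := fun m hm => by
    have h := intDegree_qv_pow m
    rw [hm, RatFunc.intDegree_one] at h
    exact_mod_cast h.symm
  rcases Int.eq_nat_or_neg n with ⟨m, rfl | rfl⟩
  · intro h
    rw [zpow_natCast] at h
    exact hn (by simp [key m h])
  · intro h
    rw [zpow_neg, inv_eq_one, zpow_natCast] at h
    exact hn (by simp [key m h])

lemma qv_zpow_injective : Function.Injective fun n : ℤ => qv ^ n := by
  intro a b h
  by_contra hab
  refine qv_zpow_ne_one (sub_ne_zero.mpr hab) ?_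
  rw [zpow_sub₀ qv_ne_zero, div_eq_one_iff_eq (zpow_ne_zero _ qv_ne_zero)]
  exact h

lemma qv_zpow_sub_zpow_neg_ne_zero {n : ℤ} (hn : n ≠ 0) : qv ^ n - qv ^ (-n) ≠ 0 :=
  fun h => hn (by have := qv_zpow_injective (sub_eq_zero.mp h); omega)

lemma qv_sub_inv_ne_zero : qv - qv⁻¹ ≠ 0 := by
  simpa using qv_zpow_sub_zpow_neg_ne_zero one_ne_zero

lemma qInt_ne_zero {n : ℕ} (hn : n ≠ 0) : qInt n ≠ 0 := by
  refine div_ne_zero ?_ qv_sub_inv_ne_zero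
  have := qv_zpow_sub_zpow_neg_ne_zero (Int.natCast_ne_zero.mpr hn)
  simpa [zpow_neg, inv_pow] using this

lemma qInt_add_two (n : ℕ) :
    qInt (n + 2) = (qv + qv⁻¹) * qInt (n + 1) - qInt n := by
  have h := qv_sub_inv_ne_zero
  have hq : qv * qv⁻¹ = 1 := mul_inv_cancel₀ qv_ne_zero
  unfold qInt
  rw [← mul_div_assoc, ← sub_div]
  congr 1
  linear_combination (qv⁻¹ ^ n - qv ^ n) * hq

/-! ### Consequences of a Serre relation -/

section Serre

variable {R : Type} [Ring R] [Algebra KK R] {c : KK} {x y : R}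

lemma serre_pow (h : x * x * y - c • (x * y * x) + y * x * x = 0) (i r : ℕ) :
    x ^ (i + 2) * y * x ^ r =
      c • (x ^ (i + 1) * y * x ^ (r + 1)) - x ^ i * y * x ^ (r + 2) := by
  have h1 : x ^ i * (x * x * y - c • (x * y * x) + y * x * x) * x ^ r = 0 := by
    rw [h, mul_zero, zero_mul]
  rw [eq_sub_iff_add_eq, ← sub_eq_zero, ← h1]
  simp only [mul_add, mul_sub, add_mul, sub_mul, mul_smul_comm, smul_mul_assoc, pow_succ' x (r + 1),
    pow_succ' x r, pow_succ, mul_assoc]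
  abel

variable {V : Type} [AddCommGroup V] [Module KK V] [Module R V] [IsScalarTower KK R V] {w : V}

lemma serre_mul_mul_pow_smul_eq_zero
    (h : x * x * y - (qv + qv⁻¹) • (x * y * x) + y * x * x = 0) {j : ℕ}
    (hy : y • w = 0) (hx : x ^ (j + 1) • w = 0) : (x * y * x ^ j) • w = 0 := by
  have key : ∀ i r : ℕ, i + r = j + 1 →
      (x ^ i * y * x ^ r) • w = qInt i • (x * y * x ^ j) • w := by
    intro i
    induction i using Nat.twoStepInduction with
    | zero =>
      intro r hr
      obtain rfl : r = j + 1 := by omega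
      simp [mul_smul, hx, qInt]
    | one =>
      intro r hr
      obtain rfl : r = j := by omega
      have : qInt 1 = 1 := by simp [qInt, div_self qv_sub_inv_ne_zero]
      simp [this]
    | more i ih₁ ih₂ =>
      intro r hr
      rw [serre_pow h, sub_smul, smul_assoc, ih₁ _ (by omega), ih₂ _ (by omega), qInt_add_two,
        sub_smul, mul_smul (qv + qv⁻¹)]
  have h0 := key (j + 1) 0 rfl
  rw [pow_zero, mul_one, mul_smul, hy, smul_zero] at h0
  exact (smul_eq_zero.mp h0.symm).resolve_left (qInt_ne_zero (Nat.succ_ne_zero j))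

lemma serre_mul_pow_mul_pow_smul_eq_zero
    (hxy : x * x * y - (qv + qv⁻¹) • (x * y * x) + y * x * x = 0)
    (hyx : y * y * x - (qv + qv⁻¹) • (y * x * y) + x * y * y = 0) {j : ℕ}
    (hy : y • w = 0) (hx : x ^ (j + 1) • w = 0) : x • y ^ j • x ^ j • w = 0 := by
  have key : ∀ r i : ℕ, i + r = j → (y ^ i * x * y ^ r) • x ^ j • w = 0 := by
    intro r
    induction r using Nat.twoStepInduction with
    | zero =>
      intro i _
      rw [pow_zero, mul_one, mul_smul, smul_smul x, ← pow_succ', hx, smul_zero]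
    | one =>
      intro i _
      rw [pow_one, mul_assoc, mul_smul, smul_smul (x * y),
        serre_mul_mul_pow_smul_eq_zero hxy hy hx, smul_zero]
    | more r ih₁ ih₂ =>
      intro i hi
      have h := congrArg (· • x ^ j • w) (serre_pow hyx i r)
      simp only [sub_smul, smul_assoc] at h
      rw [ih₁ _ (by omega), ih₂ _ (by omega), smul_zero, zero_sub] at h
      exact neg_eq_zero.mp h.symm
  simpa [mul_smul] using key j 0 (zero_add j)

end Serre

/-! ### Vectors annihilated by `e_i` -/

section HighestWeight

variable {d : ℕ} {G : QGroup d} {V : Type} [AddCommGroup V] [Module KK V] [Module G.U V]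
  [IsScalarTower KK G.U V]

lemma K_mul_f {i l : ℕ} (hi : 1 ≤ i) (hid : i ≤ d) (hl : 1 ≤ l) (hld : l ≤ d) :
    G.K i * G.f l = qv ^ (-cartan i l) • (G.f l * G.K i) := by
  rw [← smul_mul_assoc, ← G.K_f_Kinv i l hi hid hl hld, mul_assoc, G.Kinv_mul_K i hi hid, mul_one]

lemma K_smul_f_pow_smul {i l : ℕ} (hi : 1 ≤ i) (hid : i ≤ d) (hl : 1 ≤ l) (hld : l ≤ d)
    {u : V} {n : ℤ} (hK : G.K i • u = qv ^ n • u) (s : ℕ) :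
    G.K i • G.f l ^ s • u = qv ^ (n - s * cartan i l) • G.f l ^ s • u := by
  have : SMulCommClass KK G.U V := IsScalarTower.to_smulCommClass
  induction s with
  | zero => simpa using hK
  | succ s ih =>
    rw [pow_succ', mul_smul, smul_smul (G.K i), K_mul_f hi hid hl hld, smul_assoc, mul_smul, ih,
      smul_comm (G.f l), smul_smul, ← zpow_add₀ qv_ne_zero]
    congr 2
    push_cast
    ring

lemma Kinv_smul_of_K_smul {i : ℕ} (hi : 1 ≤ i) (hid : i ≤ d) {u : V} {n : ℤ}
    (hK : G.K i • u = qv ^ n • u) : G.Kinv i • u = qv ^ (-n) • u := by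
  have : SMulCommClass KK G.U V := IsScalarTower.to_smulCommClass
  have h : u = qv ^ n • G.Kinv i • u := by
    rw [← smul_comm (G.Kinv i), ← hK, smul_smul, G.Kinv_mul_K i hi hid, one_smul]
  conv_rhs => rw [h]
  rw [smul_smul, ← zpow_add₀ qv_ne_zero, neg_add_cancel, zpow_zero, one_smul]

lemma e_smul_f_pow_smul {i : ℕ} (hi : 1 ≤ i) (hid : i ≤ d) {u : V} {n : ℤ}
    (he : G.e i • u = 0) (hK : G.K i • u = qv ^ n • u) (s : ℕ) :
    G.e i • G.f i ^ (s + 1) • u =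
      ((qv - qv⁻¹)⁻¹ ^ 2 * ((qv ^ ((s : ℤ) + 1) - qv ^ (-((s : ℤ) + 1))) *
        (qv ^ (n - s) - qv ^ (-(n - s))))) • G.f i ^ s • u := by
  have : SMulCommClass KK G.U V := IsScalarTower.to_smulCommClass
  have hne := qv_sub_inv_ne_zero
  have hq := qv_ne_zero
  have step : ∀ s : ℕ, G.e i • G.f i ^ (s + 1) • u =
      G.f i • G.e i • G.f i ^ s • u +
        ((qv - qv⁻¹)⁻¹ * (qv ^ (n - s * 2) - qv ^ (-(n - s * 2)))) • G.f i ^ s • u := by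
    intro s
    have hef := G.e_f_comm i i hi hid hi hid
    rw [if_pos rfl, sub_eq_iff_eq_add'] at hef
    have hKs := K_smul_f_pow_smul hi hid hi hid hK s
    rw [show cartan i i = 2 by simp [cartan]] at hKs
    rw [pow_succ', mul_smul, smul_smul (G.e i), hef, add_smul, mul_smul, smul_assoc, sub_smul,
      hKs, Kinv_smul_of_K_smul hi hid hKs, ← sub_smul,
      smul_smul (qv - qv⁻¹)⁻¹]
  induction s with
  | zero =>
    rw [step]
    simp only [pow_zero, one_smul, he, smul_zero, zero_add]
    congr 1
    simp
    field_simp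
  | succ s ih =>
    rw [step, ih, smul_comm (G.f i), smul_smul (G.f i), ← pow_succ', ← add_smul]
    congr 1
    rw [← mul_right_inj' (pow_ne_zero 2 hne)]
    have e1 : (qv - qv⁻¹) ^ 2 * (qv - qv⁻¹)⁻¹ ^ 2 = 1 := by
      rw [← mul_pow, mul_inv_cancel₀ hne, one_pow]
    have e2 : (qv - qv⁻¹) ^ 2 * (qv - qv⁻¹)⁻¹ = qv - qv⁻¹ := by
      rw [sq, mul_assoc, mul_inv_cancel₀ hne, mul_one]
    rw [mul_add, ← mul_assoc _ ((qv - qv⁻¹)⁻¹ ^ 2), ← mul_assoc _ ((qv - qv⁻¹)⁻¹ ^ 2),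
      ← mul_assoc _ (qv - qv⁻¹)⁻¹, e1, e2, one_mul, one_mul]
    have hmul : ∀ a b : ℤ, qv ^ a * qv ^ b = qv ^ (a + b) := fun a b =>
      (zpow_add₀ hq a b).symm
    have h1 : qv - qv⁻¹ = qv ^ (1 : ℤ) - qv ^ (-1 : ℤ) := by simp
    rw [h1]
    simp only [mul_sub, sub_mul, hmul]
    push_cast
    ring_nf

variable [FiniteDimensional KK V]

lemma exists_f_pow_smul_eq_zero {i : ℕ} (hi : 1 ≤ i) (hid : i ≤ d) {u : V} {n : ℤ}
    (hK : G.K i • u = qv ^ n • u) : ∃ N : ℕ, G.f i ^ N • u = 0 := by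
  have : SMulCommClass KK G.U V := IsScalarTower.to_smulCommClass
  by_contra! h
  have hinj : Function.Injective fun s : ℕ => qv ^ (n - s * cartan i i) := fun s t hst => by
    have := qv_zpow_injective hst
    simp only [cartan, if_true] at this
    omega
  have hlin := Module.End.eigenvectors_linearIndependent' (Module.toModuleEnd KK V (G.K i))
    (fun s : ℕ => qv ^ (n - s * cartan i i)) hinj (fun s => G.f i ^ s • u) fun s =>
      Module.End.hasEigenvector_iff.mpr
        ⟨Module.End.mem_eigenspace_iff.mpr (K_smul_f_pow_smul hi hid hi hid hK s), h s⟩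
  exact not_finite_iff_infinite.mpr inferInstance hlin.finite

lemma f_pow_succ_smul_eq_zero {i : ℕ} (hi : 1 ≤ i) (hid : i ≤ d) {u : V} {n : ℕ}
    (he : G.e i • u = 0) (hK : G.K i • u = qv ^ (n : ℤ) • u) : G.f i ^ (n + 1) • u = 0 := by
  classical
  have hex := exists_f_pow_smul_eq_zero hi hid hK
  have hN := Nat.find_spec hex
  have hmin := fun m => Nat.find_min hex (m := m)
  generalize Nat.find hex = N at hN hmin
  rcases N with _ | s
  · rw [pow_zero, one_smul] at hN
    rw [hN, smul_zero]
  · have h := e_smul_f_pow_smul hi hid he hK s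
    rw [hN, smul_zero] at h
    have h0 := (smul_eq_zero.mp h.symm).resolve_right (hmin s (Nat.lt_succ_self s))
    have hs : s = n := by
      by_contra hsn
      refine mul_ne_zero (pow_ne_zero 2 (inv_ne_zero qv_sub_inv_ne_zero)) (mul_ne_zero ?_ ?_) h0
      · exact qv_zpow_sub_zpow_neg_ne_zero (by omega)
      · exact qv_zpow_sub_zpow_neg_ne_zero (by omega)
    rwa [← hs]

end HighestWeight

/-! ### Chains of divided powers -/

section Chain

variable {d : ℕ} {G : QGroup d} {V : Type} [AddCommGroup V] [Module G.U V]

lemma fDivChain_succ (c : ℕ → ℕ) {a b : ℕ} (hab : a ≤ b + 1) (v : V) :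
    fDivChain G c a (b + 1) v = fDiv G (b + 1) (c (b + 1)) • fDivChain G c a b v := by
  unfold fDivChain
  rw [show b + 1 + 1 - a = (b + 1 - a) + 1 by omega, List.range_succ, List.foldl_append]
  simp only [List.foldl_cons, List.foldl_nil]
  rw [show a + (b + 1 - a) = b + 1 by omega]

lemma smul_foldl_fDiv_eq_zero (c : ℕ → ℕ) (a : ℕ) {x : G.U} {v : V} (hv : x • v = 0) (t : ℕ)
    (hx : ∀ r < t, Commute x (G.f (a + r))) :
    x • (List.range t).foldl (fun u r => fDiv G (a + r) (c (a + r)) • u) v = 0 := by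
  induction t with
  | zero => simpa using hv
  | succ t ih =>
    rw [List.range_succ, List.foldl_append, List.foldl_cons, List.foldl_nil, smul_smul]
    have : Commute x (fDiv G (a + t) (c (a + t))) :=
      ((hx t (Nat.lt_succ_self t)).pow_right _).smul_right _
    rw [this.eq, mul_smul, ih fun r hr => hx r (by omega), smul_zero]

end Chain

/-- Proposition `tech` (3):  for `λ = m ω_a`, for all
`a + 1 ≤ a' ≤ k - 2` and `0 ≤ j ≤ m`,
`f_{a'} f_{a'+1}^{(j)} f_{a'}^{(j)} ⋯ f_a^{(j)} v_λ = 0`. -/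
theorem f_kills_divided_power_chain
    (k a m a' j : ℕ) (hk : 4 ≤ k) (ha : 1 ≤ a) (hak : a ≤ k - 3) (hm : 1 ≤ m)
    (haa' : a + 1 ≤ a') (ha'k : a' ≤ k - 2) (hj : j ≤ m)
    (G : QGroup (k - 1)) (V : Type) [AddCommGroup V] [Module KK V] [Module G.U V]
    [IsScalarTower KK G.U V]
    (v : V) (hV : IsHWModule G (omWt a m) v) :
    G.f a' • fDivChain G (fun _ => j) a (a' + 1) v = 0 := by
  have := hV.findim
  have : SMulCommClass KK G.U V := IsScalarTower.to_smulCommClass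
  obtain ⟨n, rfl⟩ : ∃ n, a' = a + n + 1 := ⟨a' - a - 1, by omega⟩
  have he (i : ℕ) (h1 : 1 ≤ i) (h2 : i ≤ k - 1) (r : ℕ) (hr : r ≤ n) (hi : a + n + 1 ≤ i) :
      Commute (G.e i) (G.f (a + r)) := by
    have := G.e_f_comm i (a + r) h1 h2 (by omega) (by omega)
    rwa [if_neg (by omega), sub_eq_zero] at this
  have hKv : G.K (a + n + 1) • v = v := by
    have := hV.wt (a + n + 1) (by omega) (by omega)
    rwa [omWt, if_neg (by omega), zpow_zero, one_smul] at this
  have hfv : G.f (a + n + 1 + 1) • v = 0 := by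
    have hK := hV.wt (a + n + 1 + 1) (by omega) (by omega)
    rw [omWt, if_neg (by omega)] at hK
    simpa using f_pow_succ_smul_eq_zero (n := 0) (by omega) (by omega)
      (hV.hw (a + n + 1 + 1) (by omega) (by omega)) (by simpa using hK)
  have hlen : a + n + 1 - a = n + 1 := by omega
  -- the part of the chain that precedes the last two divided powers
  set w := fDivChain G (fun _ => j) a (a + n) v with hw
  have hew : G.e (a + n + 1) • w = 0 := by
    rw [hw, fDivChain, hlen]
    exact smul_foldl_fDiv_eq_zero (fun _ => j) a (hV.hw _ (by omega) (by omega)) (n + 1) fun r hr =>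
      he _ (by omega) (by omega) r (by omega) le_rfl
  have hfw : G.f (a + n + 1 + 1) • w = 0 := by
    rw [hw, fDivChain, hlen]
    exact smul_foldl_fDiv_eq_zero (fun _ => j) a hfv (n + 1) fun r hr =>
      G.comm_f _ _ (by omega) (by omega) (by omega) (by omega) (by omega)
  have hKw : G.K (a + n + 1) • w = qv ^ (j : ℤ) • w := by
    rw [hw, fDivChain, hlen, List.range_succ, List.foldl_append, List.foldl_cons, List.foldl_nil]
    set u := (List.range n).foldl (fun u r => fDiv G (a + r) j • u) v with hu
    have hKu : G.K (a + n + 1) • u = qv ^ (0 : ℤ) • u := by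
      rw [zpow_zero, one_smul, ← sub_eq_zero]
      have h := smul_foldl_fDiv_eq_zero (fun _ => j) a (x := G.K (a + n + 1) - 1) (v := v)
        (by rw [sub_smul, hKv, one_smul, sub_self]) n fun r hr => by
          refine Commute.sub_left ?_ (Commute.one_left _)
          have h := K_mul_f (G := G) (i := a + n + 1) (l := a + r) (by omega) (by omega) (by omega)
            (by omega)
          rwa [cartan, if_neg (by omega), if_neg (by omega), neg_zero, zpow_zero, one_smul] at h
      rwa [sub_smul, one_smul] at h
    have h := K_smul_f_pow_smul (l := a + n) (by omega) (by omega) (by omega) (by omega) hKu j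
    rw [cartan, if_neg (by omega), if_pos (by omega)] at h
    rw [fDiv, smul_assoc, smul_comm (G.K _), h, smul_comm (qv ^ (j : ℤ))]
    simp
  rw [fDivChain_succ _ (by omega), fDivChain_succ _ (by omega), ← hw]
  simp only [fDiv, smul_assoc]
  rw [smul_comm (G.f (a + n + 1 + 1) ^ j) (qFact j)⁻¹, smul_comm (G.f (a + n + 1)) (qFact j)⁻¹,
    smul_comm (G.f (a + n + 1)) (qFact j)⁻¹,
    serre_mul_pow_mul_pow_smul_eq_zero
      (G.serre_f (a + n + 1) (a + n + 1 + 1) (by omega) (by omega) (by omega) (by omega)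
        (Or.inl rfl))
      (G.serre_f (a + n + 1 + 1) (a + n + 1) (by omega) (by omega) (by omega) (by omega)
        (Or.inr rfl))
      hfw (f_pow_succ_smul_eq_zero (by omega) (by omega) hew hKw), smul_zero, smul_zero]

end QSL
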